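/- arXiv:1011.0111 — 2 statements merged into one kernel-verified Lean document; each statement's English description precedes it below -/
import Mathlib

section
/- Let {Z^m}_{m ∈ ℕ ∪ {∞}} be continuous 𝓔-valued processes, possibly defined on different probability spaces under probability measures Q^m, and let f: [0,∞) × 𝓔 → ℝ^d be measurable. Assume: (i) for each t ∈ [0,∞), the distribution of Z_t^m under Q^m is the same for all m ∈ ℕ; (ii) the laws of Z^m on C^𝓔 converge weakly: Q^m ∘ (Z^m)^{-1} ⇒ Q^∞ ∘ (Z^∞)^{-1}; (iii) E^{Q^1} ∫_0^t ‖f(u, Z_u^1)‖ du < ∞ for every t ∈ [0,∞). Then: (iv) for every m ∈ ℕ ∪ {∞}, the integral process F_t^m := ∫_0^t f(s, Z_s^m) ds is defined Q^m-almost surely; (v) Q^m[F^m ∈ C^d] = 1 for every m ∈ ℕ ∪ {∞}; (vi) the family {(s,ω) ↦ f(s, Z_s^m(ω))} is uniformly integrable with respect to the measures λ_{[0,t]} × Q^m, m ∈ ℕ ∪ {∞}, for every t ∈ [0,∞); and (vii) (Z^m, F^m) ⇒ (Z^∞, F^∞) weakly on C^𝓔 × C^d. -/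
open MeasureTheory Filter Set
open scoped ENNReal NNReal Topology Classical

noncomputable section

namespace Mimic

/-- Lebesgue measure on `[0,∞)`, modeled as `ℝ≥0`. -/
def leb : Measure ℝ≥0 := (volume : Measure ℝ).comap (↑·)

/-- The path `t ↦ ∫_0^t g(s,ω) ds`, as a continuous map when it is continuous
(and the zero path otherwise). -/
def intPath {Ω' : Type*} {V : Type*} [NormedAddCommGroup V] [NormedSpace ℝ V]
    (g : ℝ≥0 → Ω' → V) (ω : Ω') : C(ℝ≥0, V) :=
  if hc : Continuous (fun t => ∫ s in Set.Iic t, g s ω ∂leb) then ⟨_, hc⟩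
  else ContinuousMap.const _ 0

lemma leb_emb : MeasurableEmbedding ((↑) : ℝ≥0 → ℝ) :=
  MeasurableEmbedding.subtype_coe measurableSet_Ici

lemma leb_Iic_lt_top (t : ℝ≥0) : leb (Iic t) < ⊤ := by
  unfold leb
  rw [leb_emb.comap_apply]
  refine lt_of_le_of_lt (measure_mono (t := Icc (0:ℝ) t) ?_) (by simp)
  rintro _ ⟨x, hx, rfl⟩
  exact ⟨x.2, by exact_mod_cast hx⟩

instance leb_fin (t : ℝ≥0) : IsFiniteMeasure (leb.restrict (Iic t)) :=
  ⟨by simpa using leb_Iic_lt_top t⟩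

instance leb_noAtoms : NullSingletonClass leb := ⟨fun x => by
  unfold leb
  rw [leb_emb.comap_apply]; simp⟩

lemma leb_cont_int {P V : Type*} [TopologicalSpace P] [FirstCountableTopology P]
    [NormedAddCommGroup V] [NormedSpace ℝ V] (h : P → ℝ≥0 → V) (τ : P → ℝ≥0)
    (hτ : Continuous τ) (hmeas : ∀ p, AEStronglyMeasurable (h p) leb)
    (hcont : ∀ s, Continuous fun p => h p s) (b : ℝ≥0 → ℝ) (hb : ∀ p s, ‖h p s‖ ≤ b s)
    (hbi : ∀ t, IntegrableOn b (Iic t) leb) :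
    Continuous fun p => ∫ s in Iic (τ p), h p s ∂leb := by
  have e : (fun p => ∫ s in Iic (τ p), h p s ∂leb)
      = fun p => ∫ s, (Iic (τ p)).indicator (h p) s ∂leb := by
    funext p; rw [integral_indicator measurableSet_Iic]
  rw [e, continuous_iff_continuousAt]
  intro p0
  have hev : ∀ᶠ p in 𝓝 p0, τ p ≤ τ p0 + 1 := by
    have : ∀ᶠ p in 𝓝 p0, τ p < τ p0 + 1 :=
      hτ.continuousAt.eventually_lt continuousAt_const (by simp)
    exact this.mono fun p hp => hp.le
  refine continuousAt_of_dominated (bound := (Iic (τ p0 + 1)).indicator b) ?_ ?_ ?_ ?_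
  · exact Eventually.of_forall fun p => (hmeas p).indicator measurableSet_Iic
  · filter_upwards [hev] with p hp
    refine Eventually.of_forall fun s => ?_
    by_cases hs : s ≤ τ p
    · rw [indicator_of_mem (by exact hs), indicator_of_mem (by exact hs.trans hp)]
      exact hb p s
    · rw [indicator_of_notMem (by exact hs), norm_zero]
      exact indicator_nonneg (fun s _ => (norm_nonneg _).trans (hb p s)) s
  · exact (integrable_indicator_iff measurableSet_Iic).2 (hbi _)
  · have : ∀ᵐ s ∂leb, s ≠ τ p0 := by
      rw [ae_iff]; simp
    filter_upwards [this] with s hs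
    rcases lt_or_gt_of_ne hs with h1 | h1
    · have : (fun p => (Iic (τ p)).indicator (h p) s) =ᶠ[𝓝 p0] fun p => h p s := by
        filter_upwards [continuousAt_const.eventually_lt hτ.continuousAt h1] with p hp
        exact indicator_of_mem (by exact hp.le) _
      exact (hcont s).continuousAt.congr this.symm
    · have : (fun p => (Iic (τ p)).indicator (h p) s) =ᶠ[𝓝 p0] fun p => 0 := by
        filter_upwards [hτ.continuousAt.eventually_lt continuousAt_const h1] with p hp
        exact indicator_of_notMem (by simpa using hp) _
      exact continuousAt_const.congr this.symm

lemma diff_bound {Ω S T : Type*} [MeasurableSpace Ω] (Q : Measure Ω) [IsProbabilityMeasure Q]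
    [PseudoMetricSpace S] [PseudoMetricSpace T] [SecondCountableTopology S]
    [SecondCountableTopology T] [MeasurableSpace S] [BorelSpace S] [MeasurableSpace T]
    [BorelSpace T] {X : Ω → S} {Y Y' : Ω → T} (hX : AEMeasurable X Q) (hY : AEMeasurable Y Q)
    (hY' : AEMeasurable Y' Q) (φ : S × T → ℝ) (C : ℝ) (hC : ∀ x y, dist (φ x) (φ y) ≤ C)
    (L : ℝ≥0) (hL : LipschitzWith L φ) (δ ε : ℝ) (hδ : 0 < δ) (hε : 0 < ε)
    (hQ : Q {ω | ¬ dist (Y ω) (Y' ω) < δ} ≤ ENNReal.ofReal ε) :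
    |∫ ω, φ (X ω, Y ω) ∂Q - ∫ ω, φ (X ω, Y' ω) ∂Q| ≤ L * δ + C * ε := by
  have hC0 : 0 ≤ C := by
    obtain ⟨ω⟩ : Nonempty Ω := Q.nonempty_of_neZero
    exact dist_nonneg.trans (hC (X ω, Y ω) (X ω, Y ω))
  have hint : ∀ {Y : Ω → T}, AEMeasurable Y Q → Integrable (fun ω => φ (X ω, Y ω)) Q := by
    intro Y hY
    obtain ⟨ω0⟩ : Nonempty Ω := Q.nonempty_of_neZero
    refine Integrable.of_bound
      ((hL.continuous.measurable.comp_aemeasurable (hX.prodMk hY)).aestronglyMeasurable)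
      (C + ‖φ (X ω0, Y ω0)‖) (Eventually.of_forall fun ω => ?_)
    have := hC (X ω, Y ω) (X ω0, Y ω0)
    rw [dist_eq_norm] at this
    have h2 := norm_le_norm_sub_add (φ (X ω, Y ω)) (φ (X ω0, Y ω0))
    linarith
  rw [← integral_sub (hint hY) (hint hY')]
  set A := toMeasurable Q {ω | ¬ dist (Y ω) (Y' ω) < δ} with hA
  have hAm : MeasurableSet A := measurableSet_toMeasurable _ _
  have hAQ : Q.real A ≤ ε := by
    rw [measureReal_def, hA, measure_toMeasurable]
    exact ENNReal.toReal_le_of_le_ofReal hε.le hQ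
  have hbi : Integrable (fun ω => L * δ + A.indicator (fun _ => C) ω) Q :=
    (integrable_const _).add ((integrable_const _).indicator hAm)
  calc |∫ ω, (φ (X ω, Y ω) - φ (X ω, Y' ω)) ∂Q|
      ≤ ∫ ω, (L * δ + A.indicator (fun _ => C) ω) ∂Q := by
        rw [← Real.norm_eq_abs]
        refine norm_integral_le_of_norm_le hbi (Eventually.of_forall fun ω => ?_)
        rw [← dist_eq_norm]
        by_cases h : ω ∈ A
        · rw [indicator_of_mem h]
          have := hC (X ω, Y ω) (X ω, Y' ω)
          have : 0 ≤ L * δ := by positivity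
          linarith
        · rw [indicator_of_notMem h, add_zero]
          have h' : dist (Y ω) (Y' ω) < δ := by
            by_contra hh
            exact h (subset_toMeasurable Q _ hh)
          refine (hL.dist_le_mul _ _).trans ?_
          rw [Prod.dist_eq]
          simp only [dist_self]
          gcongr
          exact max_le hδ.le h'.le
    _ = L * δ + Q.real A * C := by
        rw [integral_add (integrable_const _) ((integrable_const _).indicator hAm),
          integral_indicator_const _ hAm]
        simp
    _ ≤ _ := by nlinarith

lemma approx_weak {S T : Type*} [PseudoMetricSpace S] [PseudoMetricSpace T]
    [SecondCountableTopology S]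
    [SecondCountableTopology T] [MeasurableSpace S] [BorelSpace S] [MeasurableSpace T]
    [BorelSpace T]
    {Ωm : ℕ → Type*} [∀ m, MeasurableSpace (Ωm m)]
    (Q : ∀ m, Measure (Ωm m)) [∀ m, IsProbabilityMeasure (Q m)]
    {Ωi : Type*} [MeasurableSpace Ωi] (Qi : Measure Ωi) [IsProbabilityMeasure Qi]
    (X : ∀ m, Ωm m → S) (Y : ∀ m, Ωm m → T) (Xi : Ωi → S) (Yi : Ωi → T)
    (hX : ∀ m, AEMeasurable (X m) (Q m)) (hY : ∀ m, AEMeasurable (Y m) (Q m))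
    (hXi : AEMeasurable Xi Qi) (hYi : AEMeasurable Yi Qi)
    (H : ∀ V ∈ uniformity T, ∀ ε : ℝ, 0 < ε → ∃ (Y' : ∀ m, Ωm m → T) (Yi' : Ωi → T),
      (∀ m, AEMeasurable (Y' m) (Q m)) ∧ AEMeasurable Yi' Qi ∧
      (∀ m, Q m {ω | (Y m ω, Y' m ω) ∉ V} ≤ ENNReal.ofReal ε) ∧
      Qi {ω | (Yi ω, Yi' ω) ∉ V} ≤ ENNReal.ofReal ε ∧
      ∀ g : BoundedContinuousFunction (S × T) ℝ,
        Tendsto (fun m => ∫ ω, g (X m ω, Y' m ω) ∂(Q m)) atTop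
          (𝓝 (∫ ω, g (Xi ω, Yi' ω) ∂Qi)))
    (g : BoundedContinuousFunction (S × T) ℝ) :
    Tendsto (fun m => ∫ ω, g (X m ω, Y m ω) ∂(Q m)) atTop
          (𝓝 (∫ ω, g (Xi ω, Yi ω) ∂Qi)) := by
  let μs : ℕ → ProbabilityMeasure (S × T) := fun m =>
    ⟨(Q m).map (fun ω => (X m ω, Y m ω)), Measure.isProbabilityMeasure_map ((hX m).prodMk (hY m))⟩
  let μ : ProbabilityMeasure (S × T) :=
    ⟨Qi.map (fun ω => (Xi ω, Yi ω)), Measure.isProbabilityMeasure_map (hXi.prodMk hYi)⟩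
  have e : ∀ φ : S × T → ℝ, Continuous φ → ∀ m, ∫ x, φ x ∂(μs m : Measure (S × T))
      = ∫ ω, φ (X m ω, Y m ω) ∂(Q m) := fun φ hφ m =>
    integral_map ((hX m).prodMk (hY m)) hφ.measurable.aestronglyMeasurable
  have ei : ∀ φ : S × T → ℝ, Continuous φ → ∫ x, φ x ∂(μ : Measure (S × T))
      = ∫ ω, φ (Xi ω, Yi ω) ∂Qi := fun φ hφ =>
    integral_map (hXi.prodMk hYi) hφ.measurable.aestronglyMeasurable
  have key : Tendsto μs atTop (𝓝 μ) := by
    rw [tendsto_iff_forall_lipschitz_integral_tendsto]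
    rintro φ ⟨C, hC⟩ ⟨L, hL⟩
    simp only [e φ hL.continuous, ei φ hL.continuous]
    rw [Metric.tendsto_atTop]
    intro ε hε
    have hC0 : 0 ≤ C := by
      obtain ⟨ω⟩ : Nonempty Ωi := Qi.nonempty_of_neZero
      exact dist_nonneg.trans (hC (Xi ω, Yi ω) (Xi ω, Yi ω))
    have hδ : 0 < ε / (8 * (L + 1)) := by positivity
    have hη : 0 < ε / (8 * (C + 1)) := by positivity
    obtain ⟨Y', Yi', m1, m2, q1, q2, hg⟩ := H _ (Metric.dist_mem_uniformity hδ) _ hη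
    have b1 := fun m => diff_bound (Q m) (hX m) (hY m) (m1 m) φ C hC L hL _ _ hδ hη (q1 m)
    have b2 := diff_bound Qi hXi hYi m2 φ C hC L hL _ _ hδ hη q2
    have c1 : L * (ε / (8 * (L + 1))) ≤ ε / 8 := by
      rw [← mul_div_assoc, div_le_div_iff₀ (by positivity) (by positivity)]
      nlinarith [L.2]
    have c2 : C * (ε / (8 * (C + 1))) ≤ ε / 8 := by
      rw [← mul_div_assoc, div_le_div_iff₀ (by positivity) (by positivity)]
      nlinarith
    obtain ⟨N, hN⟩ := Metric.tendsto_atTop.1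
      (hg ⟨⟨φ, hL.continuous⟩, C, hC⟩) (ε / 4) (by positivity)
    refine ⟨N, fun n hn => ?_⟩
    have := hN n hn
    have b1 := b1 n
    rw [Real.dist_eq] at *
    change |∫ ω, φ (X n ω, Y' n ω) ∂(Q n) - ∫ ω, φ (Xi ω, Yi' ω) ∂Qi| < _ at this
    rw [abs_le] at b1 b2
    rw [abs_lt] at this ⊢
    constructor <;> linarith [b1.1, b1.2, b2.1, b2.2, this.1, this.2]
  rw [ProbabilityMeasure.tendsto_iff_forall_integral_tendsto] at key
  have := key g
  simpa only [e g g.continuous, ei g g.continuous] using this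

lemma measurable_path {Ω E : Type*} [MeasurableSpace Ω] [TopologicalSpace E] [PolishSpace E]
    [MeasurableSpace E] [BorelSpace E] [MeasurableSpace C(ℝ≥0, E)] [BorelSpace C(ℝ≥0, E)]
    (F : Ω → C(ℝ≥0, E)) (hF : ∀ t, Measurable fun ω => F ω t) : Measurable F := by
  let := TopologicalSpace.metrizableSpaceMetric E
  rw [BorelSpace.measurable_eq (α := C(ℝ≥0, E)),
    borel_eq_generateFrom_of_subbasis (ContinuousMap.compactOpen_eq (X := ℝ≥0) (Y := E))]
  refine measurable_generateFrom ?_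
  rintro _ ⟨K, hK, U, hU, rfl⟩
  have hU : IsOpen U := hU
  have hK : IsCompact K := hK
  obtain ⟨D, hDc, hDd⟩ := TopologicalSpace.exists_countable_dense K
  let a : ℕ → ℝ≥0∞ := fun n => ((n : ℝ≥0∞) + 1)⁻¹
  let G : ℕ → Set E := fun n => {x | a n ≤ Metric.infEDist x Uᶜ}
  let O : ℕ → Set E := fun n => {x | a n < Metric.infEDist x Uᶜ}
  have hGc : ∀ n, IsClosed (G n) := fun n => isClosed_le continuous_const Metric.continuous_infEDist
  have hOo : ∀ n, IsOpen (O n) := fun n => isOpen_lt continuous_const Metric.continuous_infEDist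
  have hOm : Monotone O := by
    intro n m hnm x hx
    have hx : a n < Metric.infEDist x Uᶜ := hx
    change a m < _
    refine lt_of_le_of_lt ?_ hx
    simp only [a]
    gcongr
  have hGU : ∀ n, G n ⊆ U := by
    intro n x hx
    by_contra h
    have h0 : Metric.infEDist x Uᶜ = 0 := Metric.infEDist_zero_of_mem h
    have : a n ≤ 0 := h0 ▸ hx
    simp [a] at this
  have hUO : U ⊆ ⋃ n, O n := by
    intro x hx
    have : Metric.infEDist x Uᶜ ≠ 0 := fun h0 =>
      ((Metric.mem_iff_infEDist_zero_of_closed hU.isClosed_compl).2 h0) hx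
    obtain ⟨n, hn⟩ := ENNReal.exists_inv_nat_lt this
    refine mem_iUnion.2 ⟨n, lt_of_le_of_lt ?_ hn⟩
    simp only [a]
    gcongr
    simp
  have : F ⁻¹' {f : C(ℝ≥0, E) | MapsTo f K U}
      = ⋃ n, ⋂ t ∈ D, {ω | F ω t ∈ G n} := by
    ext ω
    simp only [mem_preimage, mem_iUnion, mem_iInter]
    constructor
    · intro h
      obtain ⟨n, hn⟩ := (hK.image (F ω).continuous).elim_directed_cover O hOo
        ((image_subset_iff.2 h).trans hUO) hOm.directed_le
      refine ⟨n, fun t _ => ?_⟩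
      have h2 : a n < Metric.infEDist (F ω t) Uᶜ := hn (mem_image_of_mem _ t.2)
      exact h2.le
    · rintro ⟨n, hn⟩ t ht
      have hc : IsClosed {t : K | F ω t ∈ G n} :=
        (hGc n).preimage ((F ω).continuous.comp continuous_subtype_val)
      have : closure D ⊆ {t : K | F ω t ∈ G n} := closure_minimal (fun t ht => hn t ht) hc
      exact hGU n (this (hDd ⟨t, ht⟩))
  rw [this]
  refine MeasurableSet.iUnion fun n => MeasurableSet.biInter hDc fun t _ => ?_
  exact hF t (hGc n).measurableSet

section single

variable {E : Type*} [TopologicalSpace E] [PolishSpace E] [MeasurableSpace E] [BorelSpace E]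
  {Ω : Type*} [MeasurableSpace Ω]

/-- Occupation measure of a process up to time `t`. -/
def occ (Q : Measure Ω) (Z : ℝ≥0 → Ω → E) (t : ℝ≥0) : Measure (ℝ≥0 × E) :=
  (Q.prod (leb.restrict (Iic t))).map (fun p => (p.2, Z p.2 p.1))

lemma meas_joint {Z : ℝ≥0 → Ω → E} (hm : ∀ t, Measurable (Z t))
    (hc : ∀ ω, Continuous fun t => Z t ω) :
    Measurable (fun p : Ω × ℝ≥0 => (p.2, Z p.2 p.1)) :=
  measurable_snd.prodMk
    ((measurable_uncurry_of_continuous_of_measurable hc hm).comp measurable_swap)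

lemma occ_finite (Q : Measure Ω) [IsProbabilityMeasure Q] (Z : ℝ≥0 → Ω → E) (t : ℝ≥0) :
    IsFiniteMeasure (occ Q Z t) := by
  unfold occ; infer_instance

lemma occ_lintegral (Q : Measure Ω) [IsProbabilityMeasure Q] {Z : ℝ≥0 → Ω → E}
    (hm : ∀ t, Measurable (Z t)) (hc : ∀ ω, Continuous fun t => Z t ω) (t : ℝ≥0)
    {h : ℝ≥0 × E → ℝ≥0∞} (hh : Measurable h) :
    ∫⁻ p, h p ∂(occ Q Z t) = ∫⁻ ω, ∫⁻ u in Iic t, h (u, Z u ω) ∂leb ∂Q := by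
  unfold occ
  rw [lintegral_map hh (meas_joint hm hc), lintegral_prod]
  exact (hh.comp (meas_joint hm hc)).aemeasurable

lemma occ_lintegral' (Q : Measure Ω) [IsProbabilityMeasure Q] {Z : ℝ≥0 → Ω → E}
    (hm : ∀ t, Measurable (Z t)) (hc : ∀ ω, Continuous fun t => Z t ω) (t : ℝ≥0)
    {h : ℝ≥0 × E → ℝ≥0∞} (hh : Measurable h) :
    ∫⁻ p, h p ∂(occ Q Z t) = ∫⁻ u in Iic t, ∫⁻ x, h (u, x) ∂(Q.map (Z u)) ∂leb := by
  rw [occ_lintegral Q hm hc t hh, lintegral_lintegral_swap]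
  · refine lintegral_congr fun u => ?_
    exact (lintegral_map (f := fun x => h (u, x))
      (hh.comp (measurable_const.prodMk measurable_id)) (hm u)).symm
  · exact (hh.comp (meas_joint hm hc)).aemeasurable

lemma occ_eq {Ω' : Type*} [MeasurableSpace Ω'] (Q : Measure Ω) [IsProbabilityMeasure Q]
    {Z : ℝ≥0 → Ω → E}
    (hm : ∀ t, Measurable (Z t)) (hc : ∀ ω, Continuous fun t => Z t ω)
    (Q' : Measure Ω') [IsProbabilityMeasure Q'] {Z' : ℝ≥0 → Ω' → E}
    (hm' : ∀ t, Measurable (Z' t)) (hc' : ∀ ω, Continuous fun t => Z' t ω)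
    (h : ∀ t, Q.map (Z t) = Q'.map (Z' t)) (t : ℝ≥0) : occ Q Z t = occ Q' Z' t := by
  refine Measure.ext_of_lintegral _ fun g hg => ?_
  rw [occ_lintegral' Q hm hc t hg, occ_lintegral' Q' hm' hc' t hg]
  simp only [h]

variable {V : Type*} [NormedAddCommGroup V] [NormedSpace ℝ V] [MeasurableSpace V] [BorelSpace V]
  [SecondCountableTopology V] [CompleteSpace V]

lemma path_meas {Z : ℝ≥0 → Ω → E} (hc : ∀ ω, Continuous fun t => Z t ω)
    {f : ℝ≥0 × E → V} (hf : Measurable f) (ω : Ω) : Measurable fun s => f (s, Z s ω) :=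
  hf.comp (measurable_id.prodMk (hc ω).measurable)

lemma good_meas {Z : ℝ≥0 → Ω → E} (hm : ∀ t, Measurable (Z t))
    (hc : ∀ ω, Continuous fun t => Z t ω) {f : ℝ≥0 × E → V} (hf : Measurable f) (t : ℝ≥0) :
    Measurable fun ω => ∫⁻ u in Iic t, ‖f (u, Z u ω)‖ₑ ∂leb :=
  Measurable.lintegral_prod_right' (f := fun p : Ω × ℝ≥0 => ‖f (p.2, Z p.2 p.1)‖ₑ)
    (hf.enorm.comp (meas_joint hm hc))

lemma good_iff {Z : ℝ≥0 → Ω → E}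
    (hc : ∀ ω, Continuous fun t => Z t ω) {f : ℝ≥0 × E → V} (hf : Measurable f) (ω : Ω) :
    (∀ n : ℕ, ∫⁻ u in Iic (n : ℝ≥0), ‖f (u, Z u ω)‖ₑ ∂leb < ⊤) ↔
      ∀ t, IntegrableOn (fun s => f (s, Z s ω)) (Iic t) leb := by
  constructor
  · intro h t
    obtain ⟨n, hn⟩ := exists_nat_ge t
    have : IntegrableOn (fun s => f (s, Z s ω)) (Iic (n : ℝ≥0)) leb :=
      ⟨(path_meas hc hf ω).aestronglyMeasurable, h n⟩
    exact this.mono_set (Iic_subset_Iic.2 hn)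
  · intro h n
    exact (h n).2

lemma good_ae (Q : Measure Ω) [IsProbabilityMeasure Q] {Z : ℝ≥0 → Ω → E}
    (hm : ∀ t, Measurable (Z t))
    (hc : ∀ ω, Continuous fun t => Z t ω) {f : ℝ≥0 × E → V} (hf : Measurable f)
    (hfi : ∀ t, Integrable f (occ Q Z t)) :
    ∀ᵐ ω ∂Q, ∀ t, IntegrableOn (fun s => f (s, Z s ω)) (Iic t) leb := by
  simp only [← good_iff hc hf]
  rw [ae_all_iff]
  intro n
  refine ae_lt_top (good_meas hm hc hf n) ?_
  rw [← occ_lintegral Q hm hc n hf.enorm]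
  exact (hfi n).2.ne

lemma good_cont {Z : ℝ≥0 → Ω → E}
    (hc : ∀ ω, Continuous fun t => Z t ω) {f : ℝ≥0 × E → V} (hf : Measurable f) (ω : Ω)
    (h : ∀ t, IntegrableOn (fun s => f (s, Z s ω)) (Iic t) leb) :
    Continuous fun t => ∫ s in Iic t, f (s, Z s ω) ∂leb :=
  leb_cont_int (fun _ s => f (s, Z s ω)) id continuous_id
    (fun _ => (path_meas hc hf ω).aestronglyMeasurable) (fun _ => continuous_const)
    (fun s => ‖f (s, Z s ω)‖) (fun _ _ => le_rfl) (fun t => (h t).norm)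

lemma intPath_aemeas [MeasurableSpace C(ℝ≥0, V)] [BorelSpace C(ℝ≥0, V)]
    (Q : Measure Ω) [IsProbabilityMeasure Q] {Z : ℝ≥0 → Ω → E}
    (hm : ∀ t, Measurable (Z t))
    (hc : ∀ ω, Continuous fun t => Z t ω) {f : ℝ≥0 × E → V} (hf : Measurable f)
    (hfi : ∀ t, Integrable f (occ Q Z t)) :
    AEMeasurable (intPath fun s ω => f (s, Z s ω)) Q := by
  let A : Set Ω := {ω | ∀ n : ℕ, ∫⁻ u in Iic (n : ℝ≥0), ‖f (u, Z u ω)‖ₑ ∂leb < ⊤}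
  have hA : MeasurableSet A := by
    have : A = ⋂ n : ℕ, {ω | ∫⁻ u in Iic (n : ℝ≥0), ‖f (u, Z u ω)‖ₑ ∂leb < ⊤} := by
      ext ω; simp [A]
    rw [this]
    exact MeasurableSet.iInter fun n => measurableSet_lt (good_meas hm hc hf n) measurable_const
  refine ⟨A.indicator (intPath fun s ω => f (s, Z s ω)), measurable_path _ fun t => ?_, ?_⟩
  · have : (fun ω => A.indicator (intPath fun s ω => f (s, Z s ω)) ω t)
        = A.indicator (fun ω => ∫ s in Iic t, f (s, Z s ω) ∂leb) := by
      funext ω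
      by_cases h : ω ∈ A
      · rw [indicator_of_mem h, indicator_of_mem h, intPath,
          dif_pos (good_cont hc hf ω ((good_iff hc hf ω).1 h))]
        rfl
      · rw [indicator_of_notMem h, indicator_of_notMem h]; rfl
    rw [this]
    refine Measurable.indicator ?_ hA
    exact (StronglyMeasurable.integral_prod_right'
      (f := fun p : Ω × ℝ≥0 => f (p.2, Z p.2 p.1))
      (hf.comp (meas_joint hm hc)).stronglyMeasurable).measurable
  · filter_upwards [good_ae Q hm hc hf hfi] with ω hω
    rw [indicator_of_mem]
    exact (good_iff hc hf ω).2 hω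

/-- The integral functional associated to a bounded continuous integrand. -/
def bcPath (g : BoundedContinuousFunction (ℝ≥0 × E) V) (z : C(ℝ≥0, E)) : C(ℝ≥0, V) where
  toFun t := ∫ s in Iic t, g (s, z s) ∂leb
  continuous_toFun := leb_cont_int (fun _ s => g (s, z s)) id continuous_id
    (fun _ => (g.continuous.comp
      (continuous_id.prodMk z.continuous)).measurable.aestronglyMeasurable)
    (fun _ => continuous_const) (fun _ => ‖g‖) (fun _ _ => g.norm_coe_le_norm _)
    (fun _ => integrable_const _)

lemma bcPath_cont (g : BoundedContinuousFunction (ℝ≥0 × E) V) : Continuous (bcPath g) := by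
  refine ContinuousMap.continuous_of_continuous_uncurry _ ?_
  exact leb_cont_int (P := C(ℝ≥0, E) × ℝ≥0) (fun p s => g (s, p.1 s)) (fun p => p.2)
    continuous_snd
    (fun p => (g.continuous.comp
      (continuous_id.prodMk p.1.continuous)).measurable.aestronglyMeasurable)
    (fun s => g.continuous.comp (continuous_const.prodMk
      ((continuous_eval_const (F := C(ℝ≥0, E)) s).comp continuous_fst)))
    (fun _ => ‖g‖) (fun _ _ => g.norm_coe_le_norm _)
    (fun _ => integrable_const _)

lemma entourage_markov (Q : Measure Ω) [IsProbabilityMeasure Q] {Z : ℝ≥0 → Ω → E}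
    (hm : ∀ t, Measurable (Z t))
    (hc : ∀ ω, Continuous fun t => Z t ω) {f : ℝ≥0 × E → V} (hf : Measurable f)
    (hfi : ∀ t, Integrable f (occ Q Z t)) (g : BoundedContinuousFunction (ℝ≥0 × E) V)
    (T : ℝ≥0) (η ε : ℝ) (hη : 0 < η)
    (hg : ∫⁻ p, ‖f p - g p‖ₑ ∂(occ Q Z T) ≤ ENNReal.ofReal (ε * η))
    (W : Set (C(ℝ≥0, V) × C(ℝ≥0, V)))
    (hW : ∀ x y : C(ℝ≥0, V), (∀ t ≤ T, dist (x t) (y t) < η) → (x, y) ∈ W) :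
    Q {ω | (intPath (fun s ω => f (s, Z s ω)) ω, bcPath g ⟨fun t => Z t ω, hc ω⟩) ∉ W}
      ≤ ENNReal.ofReal ε := by
  have hfg : Measurable fun p => f p - g p := hf.sub g.continuous.measurable
  let D : Ω → ℝ≥0∞ := fun ω => ∫⁻ u in Iic T, ‖f (u, Z u ω) - g (u, Z u ω)‖ₑ ∂leb
  have hD : Measurable D := good_meas hm hc hfg T
  have h1 : Q {ω | (intPath (fun s ω => f (s, Z s ω)) ω, bcPath g ⟨fun t => Z t ω, hc ω⟩) ∉ W}
      ≤ Q {ω | ENNReal.ofReal η ≤ D ω} := by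
    refine measure_mono_ae ?_
    filter_upwards [good_ae Q hm hc hf hfi] with ω hω hn
    by_contra hlt
    have hlt : D ω < ENNReal.ofReal η := not_le.1 hlt
    refine hn (hW _ _ fun t ht => ?_)
    rw [intPath, dif_pos (good_cont hc hf ω hω)]
    change dist (∫ s in Iic t, f (s, Z s ω) ∂leb) (∫ s in Iic t, g (s, Z s ω) ∂leb) < η
    have hgi : IntegrableOn (fun s => g (s, Z s ω)) (Iic t) leb :=
      Integrable.of_bound (path_meas hc g.continuous.measurable ω).aestronglyMeasurable ‖g‖
        (Eventually.of_forall fun s => g.norm_coe_le_norm _)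
    rw [dist_eq_norm, ← integral_sub (hω t) hgi]
    have h2 : ‖∫ s in Iic t, (f (s, Z s ω) - g (s, Z s ω)) ∂leb‖ₑ ≤ D ω :=
      (enorm_integral_le_lintegral_enorm _).trans
        (lintegral_mono_set (Iic_subset_Iic.2 ht))
    have h3 := h2.trans_lt hlt
    rw [← ofReal_norm, ENNReal.ofReal_lt_ofReal_iff hη] at h3
    exact h3
  refine h1.trans ?_
  have h4 := mul_meas_ge_le_lintegral (μ := Q) hD (ENNReal.ofReal η)
  have h5 : ∫⁻ ω, D ω ∂Q ≤ ENNReal.ofReal (ε * η) := by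
    rw [← occ_lintegral Q hm hc T hfg.enorm]; exact hg
  have h6 := h4.trans h5
  rw [mul_comm ε η, ENNReal.ofReal_mul hη.le] at h6
  rwa [ENNReal.mul_le_mul_iff_right (by simpa using hη) ENNReal.ofReal_ne_top] at h6

end single

/-- **Proposition.** Let `Z^m`, `m ∈ ℕ ∪ {∞}`, be continuous `𝓔`-valued
processes on probability spaces `(Ω^m, Q^m)` such that (i) the law of `Z_t^m`
does not depend on `m ∈ ℕ`, (ii) the laws of `Z^m` converge weakly to the law
of `Z^∞` on `C^𝓔`, and (iii) `E^{Q^1}∫_0^t ‖f(u,Z_u^1)‖ du < ∞`.  Then the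
integral processes `F^m_t := ∫_0^t f(s,Z^m_s) ds` are a.s. defined and
continuous, the integrands are uniformly integrable, and
`(Z^m, F^m) ⇒ (Z^∞, F^∞)`. -/
theorem weak_convergence_of_integral_process
    {E : Type} [TopologicalSpace E] [PolishSpace E] [MeasurableSpace E] [BorelSpace E]
    {d : ℕ} (hd : 0 < d)
    -- the spaces and processes indexed by `m ∈ ℕ`
    {Ωm : ℕ → Type} [∀ m, MeasurableSpace (Ωm m)]
    (Q : ∀ m, Measure (Ωm m)) [∀ m, IsProbabilityMeasure (Q m)]
    (Z : ∀ m, ℝ≥0 → Ωm m → E)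
    (hZmeas : ∀ m t, Measurable (Z m t))
    (hZcont : ∀ m ω, Continuous fun t => Z m t ω)
    -- the limiting space and process (`m = ∞`)
    {Ωi : Type} [MeasurableSpace Ωi]
    (Qi : Measure Ωi) [IsProbabilityMeasure Qi]
    (Zi : ℝ≥0 → Ωi → E)
    (hZimeas : ∀ t, Measurable (Zi t))
    (hZicont : ∀ ω, Continuous fun t => Zi t ω)
    (f : ℝ≥0 × E → EuclideanSpace ℝ (Fin d)) (hf : Measurable f)
    -- (i) the distribution of `Z_t^m` under `Q^m` is independent of `m ∈ ℕ`
    (hsamelaw : ∀ t : ℝ≥0, ∀ m m' : ℕ, (Q m).map (Z m t) = (Q m').map (Z m' t))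
    -- (ii) `Q^m ∘ (Z^m)⁻¹ ⇒ Q^∞ ∘ (Z^∞)⁻¹` on `C^𝓔`
    (hweak : ∀ g : BoundedContinuousFunction C(ℝ≥0, E) ℝ,
      Tendsto (fun m : ℕ =>
          ∫ ω, g ⟨fun t => Z m t ω, hZcont m ω⟩ ∂(Q m))
        atTop (𝓝 (∫ ω, g ⟨fun t => Zi t ω, hZicont ω⟩ ∂Qi)))
    -- (iii) `E^{Q^1} ∫_0^t ‖f(u,Z_u^1)‖ du < ∞` for every `t`
    (hfint : ∀ t : ℝ≥0,
      ∫⁻ ω, (∫⁻ u in Set.Iic t, (‖f (u, Z 0 u ω)‖₊ : ℝ≥0∞) ∂leb) ∂(Q 0) < ⊤) :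
    -- (iv) the integral processes are a.s. defined
    ((∀ m, ∀ᵐ ω ∂(Q m), ∀ t : ℝ≥0,
        IntegrableOn (fun s => f (s, Z m s ω)) (Set.Iic t) leb) ∧
      (∀ᵐ ω ∂Qi, ∀ t : ℝ≥0,
        IntegrableOn (fun s => f (s, Zi s ω)) (Set.Iic t) leb)) ∧
    -- (v) the integral processes are a.s. continuous
    ((∀ m, ∀ᵐ ω ∂(Q m),
        Continuous fun t => ∫ s in Set.Iic t, f (s, Z m s ω) ∂leb) ∧
      (∀ᵐ ω ∂Qi,
        Continuous fun t => ∫ s in Set.Iic t, f (s, Zi s ω) ∂leb)) ∧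
    -- (vi) uniform integrability of the integrands over `m ∈ ℕ ∪ {∞}`
    (∀ t : ℝ≥0, ∀ ε : ℝ, 0 < ε → ∃ M : ℝ,
      (∀ m, ∫⁻ ω, (∫⁻ u in Set.Iic t,
          (if M ≤ ‖f (u, Z m u ω)‖ then (‖f (u, Z m u ω)‖₊ : ℝ≥0∞) else 0)
            ∂leb) ∂(Q m) ≤ ENNReal.ofReal ε) ∧
        ∫⁻ ω, (∫⁻ u in Set.Iic t,
          (if M ≤ ‖f (u, Zi u ω)‖ then (‖f (u, Zi u ω)‖₊ : ℝ≥0∞) else 0)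
            ∂leb) ∂Qi ≤ ENNReal.ofReal ε) ∧
    -- (vii) `(Z^m, F^m) ⇒ (Z^∞, F^∞)` on `C^𝓔 × C^d`
    (∀ g : BoundedContinuousFunction
        (C(ℝ≥0, E) × C(ℝ≥0, EuclideanSpace ℝ (Fin d))) ℝ,
      Tendsto (fun m : ℕ =>
          ∫ ω, g (⟨fun t => Z m t ω, hZcont m ω⟩,
            intPath (fun s ω' => f (s, Z m s ω')) ω) ∂(Q m))
        atTop
        (𝓝 (∫ ω, g (⟨fun t => Zi t ω, hZicont ω⟩,
            intPath (fun s ω' => f (s, Zi s ω')) ω) ∂Qi))) := by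
  -- marginals of the limit
  have hlim : ∀ t, Qi.map (Zi t) = (Q 0).map (Z 0 t) := by
    intro t
    have := Measure.isProbabilityMeasure_map (μ := Qi) (hZimeas t).aemeasurable
    have := Measure.isProbabilityMeasure_map (μ := Q 0) (hZmeas 0 t).aemeasurable
    refine ext_of_forall_integral_eq_of_IsFiniteMeasure fun φ => ?_
    have hw := hweak (φ.compContinuous ⟨fun z => z t, continuous_eval_const t⟩)
    rw [integral_map (hZimeas t).aemeasurable φ.continuous.measurable.aestronglyMeasurable]
    refine tendsto_nhds_unique hw ?_
    have : ∀ m, ∫ ω, (φ.compContinuous ⟨fun z : C(ℝ≥0, E) => z t, continuous_eval_const t⟩)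
        ⟨fun t => Z m t ω, hZcont m ω⟩ ∂(Q m) = ∫ x, φ x ∂((Q 0).map (Z 0 t)) := by
      intro m
      rw [hsamelaw t 0 m,
        integral_map (hZmeas m t).aemeasurable φ.continuous.measurable.aestronglyMeasurable]
      rfl
    simp only [this]
    exact tendsto_const_nhds
  have hocc : ∀ m t, occ (Q m) (Z m) t = occ (Q 0) (Z 0) t := fun m t =>
    occ_eq _ (hZmeas m) (hZcont m) _ (hZmeas 0) (hZcont 0) (fun t => hsamelaw t m 0) t
  have hocci : ∀ t, occ Qi Zi t = occ (Q 0) (Z 0) t := fun t =>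
    occ_eq _ hZimeas hZicont _ (hZmeas 0) (hZcont 0) hlim t
  have hfi0 : ∀ t, Integrable f (occ (Q 0) (Z 0) t) := by
    intro t
    refine ⟨hf.aestronglyMeasurable, ?_⟩
    rw [HasFiniteIntegral, occ_lintegral (Q 0) (hZmeas 0) (hZcont 0) t hf.enorm]
    exact hfint t
  have hfi : ∀ m t, Integrable f (occ (Q m) (Z m) t) := fun m t => by
    rw [hocc]; exact hfi0 t
  have hfii : ∀ t, Integrable f (occ Qi Zi t) := fun t => by
    rw [hocci]; exact hfi0 t
  refine ⟨⟨fun m => good_ae (Q m) (hZmeas m) (hZcont m) hf (hfi m),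
    good_ae Qi hZimeas hZicont hf hfii⟩, ⟨fun m => ?_, ?_⟩, ?_, ?_⟩
  · filter_upwards [good_ae (Q m) (hZmeas m) (hZcont m) hf (hfi m)] with ω hω
    exact good_cont (hZcont m) hf ω hω
  · filter_upwards [good_ae Qi hZimeas hZicont hf hfii] with ω hω
    exact good_cont hZicont hf ω hω
  · intro t ε hε
    have hmeas : ∀ M : ℝ, Measurable fun p : ℝ≥0 × E =>
        if M ≤ ‖f p‖ then (‖f p‖₊ : ℝ≥0∞) else 0 := fun M =>
      Measurable.ite (measurableSet_le measurable_const hf.norm) hf.enorm measurable_const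
    have hT : Tendsto (fun n : ℕ => ∫⁻ p, (if (n : ℝ) ≤ ‖f p‖ then (‖f p‖₊ : ℝ≥0∞) else 0)
        ∂(occ (Q 0) (Z 0) t)) atTop (𝓝 (∫⁻ _, 0 ∂(occ (Q 0) (Z 0) t))) := by
      refine tendsto_lintegral_of_dominated_convergence (fun p => ‖f p‖ₑ) (fun n => hmeas n)
        (fun n => Eventually.of_forall fun p => ?_) (hfi0 t).2.ne
        (Eventually.of_forall fun p => ?_)
      · dsimp only
        split_ifs
        · exact le_rfl
        · exact zero_le
      · obtain ⟨N, hN⟩ := exists_nat_gt ‖f p‖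
        refine tendsto_const_nhds.congr' ?_
        filter_upwards [eventually_ge_atTop N] with n hn
        rw [if_neg]
        have : (N : ℝ) ≤ n := by exact_mod_cast hn
        linarith
    rw [lintegral_zero] at hT
    obtain ⟨n, hn⟩ := (hT.eventually_lt_const (ENNReal.ofReal_pos.2 hε)).exists
    refine ⟨n, fun m => ?_, ?_⟩
    · rw [← occ_lintegral (Q m) (hZmeas m) (hZcont m) t (hmeas n), hocc]
      exact hn.le
    · rw [← occ_lintegral Qi hZimeas hZicont t (hmeas n), hocci]
      exact hn.le
  · let : UniformSpace E := (TopologicalSpace.metrizableSpaceMetric E).toUniformSpace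
    have : (uniformity E).IsCountablyGenerated := by
      let := TopologicalSpace.metrizableSpaceMetric E
      exact EMetric.instIsCountablyGeneratedUniformity
    letI : MeasurableSpace C(ℝ≥0, E) := borel _
    haveI : BorelSpace C(ℝ≥0, E) := ⟨rfl⟩
    letI : MeasurableSpace C(ℝ≥0, EuclideanSpace ℝ (Fin d)) := borel _
    haveI : BorelSpace C(ℝ≥0, EuclideanSpace ℝ (Fin d)) := ⟨rfl⟩
    letI : PseudoMetricSpace C(ℝ≥0, E) := UniformSpace.pseudoMetricSpace _
    letI : PseudoMetricSpace C(ℝ≥0, EuclideanSpace ℝ (Fin d)) := UniformSpace.pseudoMetricSpace _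
    have hXm : ∀ m, Measurable fun ω => (⟨fun t => Z m t ω, hZcont m ω⟩ : C(ℝ≥0, E)) := fun m =>
      measurable_path _ fun t => hZmeas m t
    have hXi : Measurable fun ω => (⟨fun t => Zi t ω, hZicont ω⟩ : C(ℝ≥0, E)) :=
      measurable_path _ fun t => hZimeas t
    refine approx_weak (S := C(ℝ≥0, E)) (T := C(ℝ≥0, EuclideanSpace ℝ (Fin d))) Q Qi
      (fun m ω => ⟨fun t => Z m t ω, hZcont m ω⟩)
      (fun m => intPath (fun s ω' => f (s, Z m s ω'))) (fun ω => ⟨fun t => Zi t ω, hZicont ω⟩)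
      (intPath (fun s ω' => f (s, Zi s ω'))) (fun m => (hXm m).aemeasurable)
      (fun m => intPath_aemeas (Q m) (hZmeas m) (hZcont m) hf (hfi m)) hXi.aemeasurable
      (intPath_aemeas Qi hZimeas hZicont hf hfii) ?_
    intro W hW ε hε
    rw [ContinuousMap.mem_compactConvergence_entourage_iff] at hW
    obtain ⟨K, U, hK, hU, hKU⟩ := hW
    obtain ⟨η, hη, hηU⟩ := Metric.mem_uniformity_dist.1 hU
    obtain ⟨T, hT⟩ := hK.bddAbove
    have hWW : ∀ x y : C(ℝ≥0, EuclideanSpace ℝ (Fin d)),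
        (∀ t ≤ T, dist (x t) (y t) < η) → (x, y) ∈ W := fun x y h =>
      hKU fun t ht => hηU (h t (hT ht))
    haveI := occ_finite (Q 0) (Z 0) T
    obtain ⟨k, hk, -⟩ := (hfi0 T).exists_boundedContinuous_lintegral_sub_le
      (ε := ENNReal.ofReal (ε * η)) (by simpa using mul_pos hε hη)
    have hbc := bcPath_cont k
    refine ⟨fun m ω => bcPath k ⟨fun t => Z m t ω, hZcont m ω⟩,
      fun ω => bcPath k ⟨fun t => Zi t ω, hZicont ω⟩,
      fun m => (hbc.measurable.comp (hXm m)).aemeasurable,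
      (hbc.measurable.comp hXi).aemeasurable, fun m => ?_, ?_, fun g => ?_⟩
    · exact entourage_markov (Q m) (hZmeas m) (hZcont m) hf (hfi m) k T η ε hη
        (by rw [hocc]; exact hk) W hWW
    · exact entourage_markov Qi hZimeas hZicont hf hfii k T η ε hη
        (by rw [hocci]; exact hk) W hWW
    · exact hweak (g.compContinuous ⟨fun z => (z, bcPath k z), continuous_id.prodMk hbc⟩)

end Mimic
end
end

section
/- Let f: [0,∞) → ℝ^d be a measurable function with ∫_0^t ‖f(s)‖ ds < ∞ for every t ∈ [0,∞). For positive integers n and i define the sets I_i^n := {(t,u) ∈ [0,∞) × [0,1] : (u+i−1)/n ≤ t < (u+i)/n}, and define f_n(t,u) := Σ_{i=1}^∞ f((u+i−1)/n) 1_{I_i^n}(t,u). Then for every t ∈ [0,∞), lim_{n→∞} ∫_0^1 ∫_0^t ‖f(s) − f_n(s,u)‖ ds du = 0. -/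
open MeasureTheory Filter Set
open scoped ENNReal NNReal Topology

noncomputable section

namespace Mimic

/-- The set `I_i^n = {(t,u) ∈ [0,∞) × [0,1] : (u+i−1)/n ≤ t < (u+i)/n}`
(as a subset of the `(t,u)`-plane; membership of `u` in `[0,1]` is imposed by
the domain of integration below). -/
def Iset (n i : ℕ) : Set (ℝ × ℝ) :=
  {p | (p.2 + i - 1) / n ≤ p.1 ∧ p.1 < (p.2 + i) / n}

/-- The sampled function
`f_n(t,u) = ∑_{i=1}^∞ f((u+i−1)/n) 1_{I_i^n}(t,u)`. -/
def sampled {V : Type*} [NormedAddCommGroup V] [CompleteSpace V]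
    [NormedSpace ℝ V] (f : ℝ → V) (n : ℕ) (t u : ℝ) : V :=
  ∑' i : ℕ, Set.indicator (Iset n (i + 1)) (fun _ => f ((u + i) / n)) (t, u)

lemma mem_Iset_iff {n : ℕ} (hn : 0 < n) (i : ℕ) (s u : ℝ) :
    (s, u) ∈ Iset n (i + 1) ↔ ⌊n * s - u⌋ = (i : ℤ) := by
  have hn' : (0 : ℝ) < n := by exact_mod_cast hn
  simp only [Iset, Set.mem_setOf_eq, Int.floor_eq_iff, div_le_iff₀ hn', lt_div_iff₀ hn']
  push_cast
  constructor
  · rintro ⟨h1, h2⟩; constructor <;> linarith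
  · rintro ⟨h1, h2⟩; constructor <;> linarith

lemma sampled_eq {V : Type*} [NormedAddCommGroup V] [CompleteSpace V]
    [NormedSpace ℝ V] (f : ℝ → V) {n : ℕ} (hn : 0 < n) {T s u : ℝ}
    (hs : s ∈ Icc 0 T) (hu : u ∈ Ico (0 : ℝ) 1) :
    sampled f n s u =
      (Icc (0 : ℝ) T).indicator f (s - Int.fract (n * s - u) / n) := by
  have hn' : (0 : ℝ) < n := by exact_mod_cast hn
  have hp : s - Int.fract (n * s - u) / n = (u + ⌊n * s - u⌋) / n := by
    rw [Int.fract]; field_simp; ring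
  have hfl := Int.floor_le (n * s - u)
  rw [hp]
  unfold sampled
  rcases lt_or_ge ⌊n * s - u⌋ 0 with hk | hk
  · have h1 : (⌊n * s - u⌋ : ℝ) ≤ -1 := by
      have : ⌊n * s - u⌋ ≤ -1 := by omega
      exact_mod_cast this
    rw [Set.indicator_of_notMem]
    · have : ∀ i : ℕ, Set.indicator (Iset n (i + 1)) (fun _ => f ((u + i) / n)) (s, u) = 0 := by
        intro i
        apply Set.indicator_of_notMem
        rw [mem_Iset_iff hn]
        omega
      simp [this]
    · intro h
      have := h.1
      have h3 : (u + ⌊n * s - u⌋) / n < 0 := div_neg_of_neg_of_pos (by linarith [hu.2]) hn'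
      linarith
  · obtain ⟨k, hk'⟩ := Int.eq_ofNat_of_zero_le hk
    rw [tsum_eq_single k]
    · rw [Set.indicator_of_mem ((mem_Iset_iff hn k s u).2 hk'), hk', Set.indicator_of_mem]
      · simp
      · rw [hk'] at hfl
        push_cast at hfl ⊢
        constructor
        · have := hu.1
          positivity
        · rw [div_le_iff₀ hn']
          nlinarith [hs.2]
    · intro i hi
      apply Set.indicator_of_notMem
      rw [mem_Iset_iff hn]
      omega

lemma lintegral_fract (G : ℝ → ℝ≥0∞) (c : ℝ) :
    ∫⁻ u in Ico (0 : ℝ) 1, G (Int.fract (c - u)) = ∫⁻ v in Ico (0 : ℝ) 1, G v := by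
  have hper : ∀ t : ℝ, ∫⁻ u in Ioc t (t + 1), G (Int.fract u)
      = ∫⁻ u in Ioc (0 : ℝ) (0 + 1), G (Int.fract u) := by
    intro t
    have hP : Function.Periodic (fun u : ℝ => G (Int.fract u)) 1 := by
      intro x; simp
    have h1 := AddCircle.lintegral_preimage (1 : ℝ) t hP.lift
    have h2 := AddCircle.lintegral_preimage (1 : ℝ) 0 hP.lift
    simp only [Function.Periodic.lift_coe] at h1 h2
    rw [h1, h2]
  have h0 : ∫⁻ v in Ico (0 : ℝ) 1, G v = ∫⁻ v in Ico (0 : ℝ) 1, G (Int.fract v) := by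
    refine setLIntegral_congr_fun measurableSet_Ico ?_
    intro v hv
    simp only
    rw [Int.fract_eq_self.2 ⟨hv.1, hv.2⟩]
  have h3 : ∫⁻ u in Ico (0 : ℝ) 1, G (Int.fract (c - u))
      = ∫⁻ u in Ioc (c - 1) (c - 1 + 1), G (Int.fract u) := by
    rw [← lintegral_indicator measurableSet_Ico, ← lintegral_indicator measurableSet_Ioc,
      ← lintegral_sub_left_eq_self _ c]
    congr 1
    ext u
    by_cases hu : c - u ∈ Ico (0 : ℝ) 1
    · rw [Set.indicator_of_mem hu, Set.indicator_of_mem, sub_sub_cancel]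
      constructor <;> linarith [hu.1, hu.2]
    · rw [Set.indicator_of_notMem hu, Set.indicator_of_notMem]
      intro h
      exact hu ⟨by linarith [h.2], by linarith [h.1]⟩
  rw [h3, hper, h0, zero_add]
  exact setLIntegral_congr Ico_ae_eq_Ioc.symm

/-- **Lemma.** Let `f : [0,∞) → ℝ^d` be measurable and locally integrable,
and let `f_n(t,u) = ∑_{i≥1} f((u+i−1)/n) 1_{I_i^n}(t,u)`.  Then for every
`t ∈ [0,∞)`, `∫_0^1 ∫_0^t ‖f(s) − f_n(s,u)‖ ds du → 0` as `n → ∞`. -/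
theorem sampled_approximation
    {d : ℕ} (hd : 0 < d)
    (f : ℝ → EuclideanSpace ℝ (Fin d)) (hf : Measurable f)
    -- `∫_0^t ‖f(s)‖ ds < ∞` for every `t ∈ [0,∞)`
    (hfint : ∀ t : ℝ, ∫⁻ s in Set.Icc (0 : ℝ) t, (‖f s‖₊ : ℝ≥0∞) < ⊤) :
    ∀ t : ℝ, 0 ≤ t →
      Tendsto (fun n : ℕ =>
          ∫⁻ u in Set.Icc (0 : ℝ) 1,
            (∫⁻ s in Set.Icc (0 : ℝ) t, (‖f s - sampled f n s u‖₊ : ℝ≥0∞)))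
        atTop (𝓝 0) := by
  intro T hT
  set h : ℝ → EuclideanSpace ℝ (Fin d) := (Icc (0 : ℝ) T).indicator f with hh
  have hm : Measurable h := hf.indicator measurableSet_Icc
  have hint : Integrable h volume := by
    rw [hh, integrable_indicator_iff measurableSet_Icc]
    exact ⟨hf.aestronglyMeasurable, hfint T⟩
  -- reduction to a translation estimate
  have key : ∀ n : ℕ, 0 < n →
      ∫⁻ u in Set.Icc (0 : ℝ) 1,
        (∫⁻ s in Set.Icc (0 : ℝ) T, (‖f s - sampled f n s u‖₊ : ℝ≥0∞))
      = ∫⁻ v in Ico (0 : ℝ) 1, ∫⁻ s in Icc (0 : ℝ) T, ‖h s - h (s - v / n)‖ₑ := by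
    intro n hn
    rw [← setLIntegral_congr (Ico_ae_eq_Icc (a := (0 : ℝ)) (b := 1))]
    have e1 : ∫⁻ u in Set.Ico (0 : ℝ) 1,
        (∫⁻ s in Set.Icc (0 : ℝ) T, (‖f s - sampled f n s u‖₊ : ℝ≥0∞))
        = ∫⁻ u in Set.Ico (0 : ℝ) 1,
        (∫⁻ s in Set.Icc (0 : ℝ) T, ‖h s - h (s - Int.fract (n * s - u) / n)‖ₑ) := by
      refine setLIntegral_congr_fun measurableSet_Ico fun u hu => ?_
      refine setLIntegral_congr_fun measurableSet_Icc fun s hs => ?_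
      rw [sampled_eq f hn hs hu, hh, Set.indicator_of_mem hs]
      rfl
    rw [e1, lintegral_lintegral_swap,
      lintegral_lintegral_swap (f := fun v s => ‖h s - h (s - v / n)‖ₑ)]
    · refine lintegral_congr fun s => ?_
      exact lintegral_fract (fun v => ‖h s - h (s - v / n)‖ₑ) (n * s)
    · apply Measurable.aemeasurable
      unfold Function.uncurry
      fun_prop
    · apply Measurable.aemeasurable
      unfold Function.uncurry
      fun_prop
  rw [ENNReal.tendsto_nhds_zero]
  intro ε hε
  by_cases hεtop : ε = ⊤
  · simp [hεtop]
  have hε3 : ε / 3 ≠ 0 := (ENNReal.div_pos hε.ne' (by norm_num)).ne'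
  obtain ⟨g, hgc, hgle, hgcont, hgint⟩ := hint.exists_hasCompactSupport_lintegral_sub_le hε3
  have huc : UniformContinuous g := hgc.uniformContinuous_of_continuous hgcont
  -- modulus
  have hδ' : 0 < (ε / 3).toReal / (T + 1) :=
    div_pos (ENNReal.toReal_pos hε3 (ENNReal.div_lt_top hεtop (by norm_num)).ne) (by linarith)
  obtain ⟨δ, hδ, hgδ⟩ := Metric.uniformContinuous_iff.1 huc _ hδ'
  obtain ⟨N, hN⟩ := exists_nat_gt (1 / δ)
  filter_upwards [eventually_ge_atTop (max N 1)] with n hn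
  have hn1 : 0 < n := by have := le_max_right N 1; omega
  have hn' : (0 : ℝ) < n := by exact_mod_cast hn1
  have hNn : (N : ℝ) ≤ n := by exact_mod_cast (le_max_left N 1).trans hn
  rw [key n hn1]
  have bound : ∀ v ∈ Ico (0 : ℝ) 1,
      ∫⁻ s in Icc (0 : ℝ) T, ‖h s - h (s - v / n)‖ₑ ≤ ε := by
    intro v hv
    have hgm : Measurable g := hgcont.measurable
    have hptw : ∀ s, ‖h s - h (s - v / n)‖ₑ ≤
        ‖h s - g s‖ₑ + ‖g s - g (s - v / n)‖ₑ + ‖h (s - v / n) - g (s - v / n)‖ₑ := by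
      intro s
      have : h s - h (s - v / n) = (h s - g s) + (g s - g (s - v / n))
          - (h (s - v / n) - g (s - v / n)) := by abel
      rw [this]
      refine enorm_sub_le.trans ?_
      gcongr
      exact enorm_add_le _ _
    have h1 : ∫⁻ s in Icc (0 : ℝ) T, ‖h s - g s‖ₑ ≤ ε / 3 :=
      (setLIntegral_le_lintegral _ _).trans hgle
    have h3 : ∫⁻ s in Icc (0 : ℝ) T, ‖h (s - v / n) - g (s - v / n)‖ₑ ≤ ε / 3 := by
      refine (setLIntegral_le_lintegral _ _).trans ?_
      rw [lintegral_sub_right_eq_self (fun s => ‖h s - g s‖ₑ) (v / n)]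
      exact hgle
    have h2 : ∫⁻ s in Icc (0 : ℝ) T, ‖g s - g (s - v / n)‖ₑ ≤ ε / 3 := by
      have hb : ∀ s, ‖g s - g (s - v / n)‖ₑ ≤ ENNReal.ofReal ((ε / 3).toReal / (T + 1)) := by
        intro s
        rw [← ofReal_norm_eq_enorm]
        apply ENNReal.ofReal_le_ofReal
        rw [← dist_eq_norm]
        apply le_of_lt
        apply hgδ
        rw [Real.dist_eq]
        have : s - (s - v / n) = v / n := by ring
        rw [this, abs_of_nonneg (div_nonneg hv.1 hn'.le), div_lt_iff₀ hn']
        rw [div_lt_iff₀ hδ] at hN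
        nlinarith [hv.2]
      calc _ ≤ ∫⁻ s in Icc (0 : ℝ) T, ENNReal.ofReal ((ε / 3).toReal / (T + 1)) :=
            lintegral_mono hb
        _ = ENNReal.ofReal ((ε / 3).toReal / (T + 1) * T) := by
            rw [setLIntegral_const, Real.volume_Icc, sub_zero, ← ENNReal.ofReal_mul hδ'.le]
        _ ≤ ENNReal.ofReal ((ε / 3).toReal) := by
            apply ENNReal.ofReal_le_ofReal
            rw [div_mul_eq_mul_div, div_le_iff₀ (by linarith)]
            nlinarith [ENNReal.toReal_nonneg (a := ε / 3)]
        _ = ε / 3 := ENNReal.ofReal_toReal (ENNReal.div_lt_top hεtop (by norm_num)).ne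
    calc _ ≤ ∫⁻ s in Icc (0 : ℝ) T, (‖h s - g s‖ₑ + ‖g s - g (s - v / n)‖ₑ
            + ‖h (s - v / n) - g (s - v / n)‖ₑ) := lintegral_mono hptw
      _ = (∫⁻ s in Icc (0 : ℝ) T, ‖h s - g s‖ₑ)
          + (∫⁻ s in Icc (0 : ℝ) T, ‖g s - g (s - v / n)‖ₑ)
          + ∫⁻ s in Icc (0 : ℝ) T, ‖h (s - v / n) - g (s - v / n)‖ₑ := by
          rw [lintegral_add_left (by fun_prop), lintegral_add_left (by fun_prop)]
      _ ≤ ε / 3 + ε / 3 + ε / 3 := by gcongr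
      _ = ε := ENNReal.add_thirds ε
  calc _ ≤ ∫⁻ v in Ico (0 : ℝ) 1, ε := setLIntegral_mono measurable_const bound
    _ = ε := by simp

end Mimic
end
end
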